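/- arXiv:1909.00460 — 3 statements merged into one kernel-verified Lean document; each statement's English description precedes it below -/
import Mathlib

section
/- In any GTF-structure (W, μ, F) and for any w ∈ W: F_w ≠ ∅ if and only if there exists an F-open set G ⊆ W with w ∈ G. -/
universe u v

/-- A generalized topology (in the sense of Császár) on `W`:
`∅ ∈ μ` and `μ` is closed under unions of nonempty subfamilies. -/
def IsGenTop {W : Type u} (μ : Set (Set W)) : Prop :=
  ∅ ∈ μ ∧ ∀ S : Set (Set W), S ⊆ μ → S.Nonempty → ⋃₀ S ∈ μ

/-- A GTF-structure `(W, μ, F)`. -/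
def IsGTF {W : Type u} (μ : Set (Set W)) (F : W → Set (Set W)) : Prop :=
  IsGenTop μ ∧
    (∀ w ∈ ⋃₀ μ, F w = {X | X ∈ μ ∧ w ∈ X}) ∧
    (∀ w ∉ ⋃₀ μ, F w ⊆ μ)

/-- `FInt F A = {w | ∃ G ∈ F w, G ⊆ A}`. -/
def FInt {W : Type u} (F : W → Set (Set W)) (A : Set W) : Set W :=
  {w | ∃ G ∈ F w, G ⊆ A}

/-- `Int(A)`: union of all members of `μ` contained in `A`. -/
def gInt {W : Type u} (μ : Set (Set W)) (A : Set W) : Set W :=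
  ⋃₀ {G | G ∈ μ ∧ G ⊆ A}

/-- `FCl F A = {w | ∀ G ∈ F w, G ∩ A ≠ ∅}`. -/
def FCl {W : Type u} (F : W → Set (Set W)) (A : Set W) : Set W :=
  {w | ∀ G ∈ F w, (G ∩ A).Nonempty}

/-- `A` is F-open iff `FInt F A = A`. -/
def FOpen {W : Type u} (F : W → Set (Set W)) (A : Set W) : Prop :=
  FInt F A = A

/-- `A` is F-closed iff `FCl F A = A`. -/
def FClosed {W : Type u} (F : W → Set (Set W)) (A : Set W) : Prop :=
  FCl F A = A

/-- `E_w`: the family of all F-open subsets of `W` containing `w`. -/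
def Egn {W : Type u} (F : W → Set (Set W)) (w : W) : Set (Set W) :=
  {S | FOpen F S ∧ w ∈ S}

/-- A gnet `f : P → W` converges to `w` iff for every `G ∈ F w`,
`f` is eventually in `G`. -/
def ConvTo {W : Type u} {P : Type v} [PartialOrder P]
    (F : W → Set (Set W)) (f : P → W) (w : W) : Prop :=
  ∀ G ∈ F w, ∃ l0 : P, ∀ l : P, l0 ≤ l → f l ∈ G

/-- A gnet `f : P → W` E-converges to `w` iff for every `S ∈ E_w`,
`f` is eventually in `S`. -/
def EConvTo {W : Type u} {P : Type v} [PartialOrder P]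
    (F : W → Set (Set W)) (f : P → W) (w : W) : Prop :=
  ∀ S ∈ Egn F w, ∃ l0 : P, ∀ l : P, l0 ≤ l → f l ∈ S

/-- The FT1 separation property. -/
def FT1 {W : Type u} (F : W → Set (Set W)) : Prop :=
  ∀ w v : W, w ≠ v → (∃ G ∈ F w, v ∉ G) ∧ (∃ H ∈ F v, w ∉ H)

/-- The set of all points with a nonempty neighbourhood family is F-open. -/
theorem IsGTF.fOpen_setOf_nonempty {W : Type u} {μ : Set (Set W)} {F : W → Set (Set W)}
    (h : IsGTF μ F) : FOpen F {v | (F v).Nonempty} := by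
  obtain ⟨-, hin, hout⟩ := h
  have hsub (v : W) : F v ⊆ μ := by
    by_cases hv : v ∈ ⋃₀ μ
    · rw [hin v hv]
      exact fun _ hX => hX.1
    · exact hout v hv
  ext v
  constructor
  · rintro ⟨G, hG, -⟩
    exact ⟨G, hG⟩
  · rintro ⟨G, hG⟩
    refine ⟨G, hG, fun x hx => ⟨G, ?_⟩⟩
    rw [hin x ⟨G, hsub v hG, hx⟩]
    exact ⟨hsub v hG, hx⟩

theorem stmt_5 {W : Type u} (μ : Set (Set W)) (F : W → Set (Set W))
    (h : IsGTF μ F) (w : W) :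
    F w ≠ ∅ ↔ ∃ G : Set W, FOpen F G ∧ w ∈ G := by
  rw [← Set.nonempty_iff_ne_empty]
  constructor
  · exact fun hw => ⟨_, h.fOpen_setOf_nonempty, hw⟩
  · rintro ⟨G, hG, hw⟩
    rw [← hG] at hw
    obtain ⟨X, hX, -⟩ := hw
    exact ⟨X, hX⟩
end

section
/- Let (W, μ, F) be a GTF-structure in which F_w ≠ ∅ for every w ∈ W. Then the following are equivalent: (1) for every nonempty partially ordered set P, every w ∈ W, and all v, u ∈ W, if the constant gnet (w) on P converges to v and converges to u, then v = u; (2) the structure is FT1. -/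
universe u v

theorem convTo_const_iff {W : Type u} {P : Type v} [PartialOrder P] [Nonempty P]
    (F : W → Set (Set W)) (w v : W) :
    ConvTo F (fun _ : P => w) v ↔ ∀ G ∈ F v, w ∈ G := by
  constructor
  · intro hc G hG
    obtain ⟨l0, hl⟩ := hc G hG
    exact hl l0 le_rfl
  · intro hw G hG
    exact ⟨Classical.arbitrary P, fun _ _ => hw G hG⟩

theorem ft1_iff_forall_mem_imp_eq {W : Type u} (F : W → Set (Set W)) :
    FT1 F ↔ ∀ w v : W, (∀ G ∈ F v, w ∈ G) → w = v := by
  constructor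
  · intro hT w v hw
    by_contra hwv
    obtain ⟨H, hH, hwH⟩ := (hT w v hwv).2
    exact hwH (hw H hH)
  · intro hF w v hwv
    constructor
    · by_contra! hc
      exact hwv (hF v w hc).symm
    · by_contra! hc
      exact hwv (hF w v hc)

theorem IsGTF.subset {W : Type u} {μ : Set (Set W)} {F : W → Set (Set W)}
    (h : IsGTF μ F) (w : W) : F w ⊆ μ := by
  by_cases hw : w ∈ ⋃₀ μ
  · rw [h.2.1 w hw]
    exact fun _ hX => hX.1
  · exact h.2.2 w hw

theorem IsGTF.mem_of_mem {W : Type u} {μ : Set (Set W)} {F : W → Set (Set W)}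
    (h : IsGTF μ F) {w : W} (hw : w ∈ ⋃₀ μ) {G : Set W} (hG : G ∈ F w) : w ∈ G := by
  rw [h.2.1 w hw] at hG
  exact hG.2

theorem stmt_12 {W : Type u} (μ : Set (Set W)) (F : W → Set (Set W))
    (h : IsGTF μ F) (hne : ∀ w : W, F w ≠ ∅) :
    (∀ (P : Type v) (inst : PartialOrder P), Nonempty P →
        ∀ w v u : W, @ConvTo W P inst F (fun _ : P => w) v →
          @ConvTo W P inst F (fun _ : P => w) u → v = u)
      ↔ FT1 F := by
  rw [ft1_iff_forall_mem_imp_eq]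
  constructor
  · intro hu w v hw
    obtain ⟨G, hG⟩ := Set.nonempty_iff_ne_empty.mpr (hne v)
    have hwμ : w ∈ ⋃₀ μ := ⟨G, h.subset v hG, hw G hG⟩
    exact hu PUnit.{v + 1} inferInstance inferInstance w w v
      ((convTo_const_iff F w w).2 fun _ hX => h.mem_of_mem hwμ hX)
      ((convTo_const_iff F w v).2 hw)
  · intro hF P _ _ w v u hv hu
    rw [convTo_const_iff] at hv hu
    exact (hF w v hv).symm.trans (hF w u hu)
end

section
/- Let (W, μ, F) be a GTF-structure such that F_w = ∅ for every w ∈ W \ ⋃μ. Then for every v ∈ W, F_v = E_v; in particular, for v ∈ W \ ⋃μ one has F_v = E_v = ∅. -/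
universe u v

/-- If orphaned points have no neighbourhoods, `F w` consists of the members of `μ`
containing `w`, for every `w`. -/
theorem IsGTF.mem_iff {W : Type u} {μ : Set (Set W)} {F : W → Set (Set W)}
    (h : IsGTF μ F) (horph : ∀ w : W, w ∉ ⋃₀ μ → F w = ∅) {w : W} {G : Set W} :
    G ∈ F w ↔ G ∈ μ ∧ w ∈ G := by
  by_cases hw : w ∈ ⋃₀ μ
  · rw [h.2.1 w hw]
    rfl
  · rw [horph w hw]
    exact ⟨False.elim, fun hG => hw ⟨G, hG⟩⟩

/-- If orphaned points have no neighbourhoods, the F-open sets are the members of `μ`. -/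
theorem IsGTF.fOpen_iff {W : Type u} {μ : Set (Set W)} {F : W → Set (Set W)}
    (h : IsGTF μ F) (horph : ∀ w : W, w ∉ ⋃₀ μ → F w = ∅) {A : Set W} :
    FOpen F A ↔ A ∈ μ := by
  constructor
  · intro hA
    have hunion : ⋃₀ {G | G ∈ μ ∧ G ⊆ A} = A := by
      refine subset_antisymm (Set.sUnion_subset fun G hG => hG.2) fun w hw => ?_
      obtain ⟨G, hG, hGA⟩ : w ∈ FInt F A := hA.symm ▸ hw
      obtain ⟨hGμ, hwG⟩ := (h.mem_iff horph).1 hG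
      exact ⟨G, ⟨hGμ, hGA⟩, hwG⟩
    rw [← hunion]
    exact h.1.2 _ (fun G hG => hG.1) ⟨∅, h.1.1, Set.empty_subset A⟩
  · intro hA
    refine subset_antisymm ?_ fun w hw => ⟨A, (h.mem_iff horph).2 ⟨hA, hw⟩, subset_rfl⟩
    rintro w ⟨G, hG, hGA⟩
    exact hGA ((h.mem_iff horph).1 hG).2

theorem stmt_17 {W : Type u} (μ : Set (Set W)) (F : W → Set (Set W))
    (h : IsGTF μ F) (horph : ∀ w : W, w ∉ ⋃₀ μ → F w = ∅) :
    (∀ v : W, F v = Egn F v) ∧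
      (∀ v : W, v ∉ ⋃₀ μ → F v = Egn F v ∧ Egn F v = ∅) := by
  have heq : ∀ v : W, F v = Egn F v := fun v => by
    ext G
    exact (h.mem_iff horph).trans (and_congr_left' (h.fOpen_iff horph).symm)
  exact ⟨heq, fun v hv => ⟨heq v, heq v ▸ horph v hv⟩⟩
end
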